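/- For n ∈ {10, 13}, τ₃(C_n) ≥ 9; that is, neither C₁₀ nor C₁₃ has a 3-tone 8-coloring. -/

import Mathlib

open SimpleGraph

/-- A `t`-tone `k`-coloring of a graph `G` assigns to each vertex a `t`-element subset of
`{1, …, k}` so that the labels of any two distinct vertices `v, w` share fewer than
`d(v,w)` colors (no constraint between different components, where the distance is infinite). -/
def IsTToneColoring {V : Type*} (G : SimpleGraph V) (t k : ℕ) (f : V → Finset ℕ) : Prop :=
  (∀ v, f v ⊆ Finset.Icc 1 k) ∧ (∀ v, (f v).card = t) ∧
    ∀ ⦃v w : V⦄, v ≠ w → ((f v ∩ f w).card : ℕ∞) < G.edist v w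

/-- The `t`-tone chromatic number: the least `k` admitting a `t`-tone `k`-coloring. -/
noncomputable def toneChromaticNumber {V : Type*} (G : SimpleGraph V) (t : ℕ) : ℕ :=
  sInf {k | ∃ f : V → Finset ℕ, IsTToneColoring G t k f}

/-- Coloring with more available colors is easier. -/
theorem IsTToneColoring.mono {V : Type*} {G : SimpleGraph V} {t k l : ℕ} {f : V → Finset ℕ}
    (hf : IsTToneColoring G t k f) (hkl : k ≤ l) : IsTToneColoring G t l f :=
  ⟨fun v => (hf.1 v).trans (Finset.Icc_subset_Icc_right hkl), hf.2⟩

/-- A graph on `Fin n` has a `t`-tone coloring with pairwise disjoint labels. -/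
theorem exists_isTToneColoring {n : ℕ} (G : SimpleGraph (Fin n)) (t : ℕ) :
    ∃ k, ∃ f : Fin n → Finset ℕ, IsTToneColoring G t k f := by
  refine ⟨t * n, fun v => Finset.Icc (t * v + 1) (t * v + t), fun v => ?_, fun v => ?_,
    fun v w hvw => ?_⟩
  · refine Finset.Icc_subset_Icc (by lia) ?_
    calc t * (v : ℕ) + t = t * (v + 1) := by ring
      _ ≤ t * n := Nat.mul_le_mul_left t v.isLt
  · simp
  · have disj : Disjoint (Finset.Icc (t * (v : ℕ) + 1) (t * v + t))
        (Finset.Icc (t * (w : ℕ) + 1) (t * w + t)) := by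
      refine Finset.disjoint_left.mpr fun x hx hy => ?_
      simp only [Finset.mem_Icc] at hx hy
      rcases lt_or_gt_of_ne (Fin.val_ne_of_ne hvw) with h | h
      · have := Nat.mul_le_mul_left t (Nat.succ_le_of_lt h)
        rw [Nat.mul_succ] at this
        lia
      · have := Nat.mul_le_mul_left t (Nat.succ_le_of_lt h)
        rw [Nat.mul_succ] at this
        lia
    rw [Finset.disjoint_iff_inter_eq_empty.mp disj, Finset.card_empty, Nat.cast_zero]
    exact SimpleGraph.edist_pos_of_ne hvw

/-- In a 3-tone 8-coloring, the labels along a path of three vertices use all eight colors. -/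
theorem IsTToneColoring.mem_of_path {V : Type*} {G : SimpleGraph V} {f : V → Finset ℕ}
    (hf : IsTToneColoring G 3 8 f) {u v w : V} (huv : G.Adj u v) (hvw : G.Adj v w) (huw : u ≠ w)
    {c : ℕ} (hc : c ∈ Finset.Icc 1 8) : c ∈ f u ∨ c ∈ f v ∨ c ∈ f w := by
  obtain ⟨hsub, hcard, hdist⟩ := hf
  have disj {a b : V} (hab : G.Adj a b) : (f a ∩ f b).card = 0 := by
    have h := hdist hab.ne
    rw [SimpleGraph.edist_eq_one_iff_adj.mpr hab] at h
    have h' : (f a ∩ f b).card < 1 := by exact_mod_cast h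
    lia
  have inter : (f u ∩ f w).card < 2 := by
    have h := (hdist huw).trans_le (SimpleGraph.Walk.edist_le (.cons huv (.cons hvw .nil)))
    simpa using Nat.cast_lt.mp h
  have h₁ := Finset.card_union_add_card_inter (f u) (f v)
  have h₂ := Finset.card_union_add_card_inter (f u ∪ f v) (f w)
  have h₃ : ((f u ∪ f v) ∩ f w).card ≤ (f u ∩ f w).card + (f v ∩ f w).card := by
    rw [Finset.union_inter_distrib_right]
    exact Finset.card_union_le _ _
  rw [disj huv, hcard, hcard] at h₁
  rw [hcard] at h₂
  rw [disj hvw] at h₃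
  have heq : f u ∪ f v ∪ f w = Finset.Icc 1 8 := by
    refine Finset.eq_of_subset_of_card_le
      (Finset.union_subset (Finset.union_subset (hsub u) (hsub v)) (hsub w)) ?_
    rw [Nat.card_Icc]
    lia
  simpa [← heq, or_assoc] using hc

/-- In a 3-tone 8-coloring of a cycle, every color is used on at least a third of the vertices. -/
theorem IsTToneColoring.card_le_three_mul {n : ℕ} {f : Fin (n + 3) → Finset ℕ}
    (hf : IsTToneColoring (cycleGraph (n + 3)) 3 8 f) {c : ℕ} (hc : c ∈ Finset.Icc 1 8) :
    n + 3 ≤ 3 * (Finset.univ.filter fun v => c ∈ f v).card := by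
  set S := Finset.univ.filter fun v => c ∈ f v with hS
  have cover : Finset.univ ⊆ S ∪ (S.image (· - 1) ∪ S.image (· - 1 - 1)) := by
    intro v _
    have hadj (a : Fin (n + 3)) : (cycleGraph (n + 3)).Adj a (a + 1) := by
      simp [cycleGraph_adj]
    have hne : v ≠ v + 1 + 1 := by
      rw [add_assoc, ne_eq, left_eq_add]
      simp [Fin.ext_iff, Fin.val_add, Nat.mod_eq_of_lt]
    rcases hf.mem_of_path (hadj v) (hadj (v + 1)) hne hc with h | h | h
    · simp [hS, h]
    · exact Finset.mem_union_right _ (Finset.mem_union_left _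
        (Finset.mem_image.mpr ⟨v + 1, by simp [hS, h], by simp⟩))
    · exact Finset.mem_union_right _ (Finset.mem_union_right _
        (Finset.mem_image.mpr ⟨v + 1 + 1, by simp [hS, h], by simp⟩))
  have h₁ := Finset.card_le_card cover
  have h₂ := Finset.card_union_le S (S.image (· - 1) ∪ S.image (· - 1 - 1))
  have h₃ := Finset.card_union_le (S.image (· - 1)) (S.image (· - 1 - 1))
  have h₄ : (S.image (· - 1)).card ≤ S.card := Finset.card_image_le
  have h₅ : (S.image (· - 1 - 1)).card ≤ S.card := Finset.card_image_le
  rw [Finset.card_univ, Fintype.card_fin] at h₁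
  lia

/-- A cycle of length `n ≥ 3` with a 3-tone 8-coloring satisfies `8 ⌈n / 3⌉ ≤ 3 n`. -/
theorem IsTToneColoring.eight_mul_le {n : ℕ} {f : Fin (n + 3) → Finset ℕ}
    (hf : IsTToneColoring (cycleGraph (n + 3)) 3 8 f) : 8 * ((n + 5) / 3) ≤ 3 * (n + 3) := by
  have count : ∑ c ∈ Finset.Icc 1 8, (Finset.univ.filter fun v => c ∈ f v).card =
      3 * (n + 3) := by
    have h := Finset.sum_card_bipartiteAbove_eq_sum_card_bipartiteBelow
      (s := Finset.Icc 1 8) (t := Finset.univ) fun (c : ℕ) v => c ∈ f v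
    simp only [Finset.bipartiteAbove, Finset.bipartiteBelow] at h
    rw [h, Finset.sum_congr rfl (g := fun _ => 3)]
    · simp [mul_comm]
    · intro v _
      rw [Finset.filter_mem_eq_inter, Finset.inter_eq_right.mpr (hf.1 v), hf.2.1 v]
  rw [← count]
  calc 8 * ((n + 5) / 3) = ∑ _c ∈ Finset.Icc 1 8, (n + 5) / 3 := by simp
    _ ≤ _ := Finset.sum_le_sum fun c hc => by
      have := hf.card_le_three_mul hc
      lia

/-- For `n ∈ {10, 13}`, `τ₃(C_n) ≥ 9`; that is, `C_n` has no 3-tone 8-coloring. -/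
theorem three_tone_C10_C13_lower (n : ℕ) (hn : n = 10 ∨ n = 13) :
    9 ≤ toneChromaticNumber (cycleGraph n) 3 ∧
      ¬ ∃ f : Fin n → Finset ℕ, IsTToneColoring (cycleGraph n) 3 8 f := by
  have none : ¬ ∃ f : Fin n → Finset ℕ, IsTToneColoring (cycleGraph n) 3 8 f := by
    rintro ⟨f, hf⟩
    rcases hn with rfl | rfl
    · exact absurd (hf.eight_mul_le (n := 7)) (by norm_num)
    · exact absurd (hf.eight_mul_le (n := 10)) (by norm_num)
  refine ⟨le_csInf (exists_isTToneColoring _ 3) ?_, none⟩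
  rintro k ⟨f, hf⟩
  by_contra! hk
  exact none ⟨f, hf.mono (Nat.le_of_lt_succ hk)⟩
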